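/- Let n ≥ 2 be an integer and ξ a real number with 2n−2 < ŵ_n(ξ) < ∞. Then w_n(ξ) is finite and w_n(ξ)/ŵ_n(ξ) ≤ (n−1)/(ŵ_n(ξ) − n). -/

import Mathlib

open Polynomial Filter

noncomputable section

/-- Height of an integer polynomial: maximum absolute value of its coefficients. -/
def polyHeight (P : Polynomial ℤ) : ℕ :=
  P.support.sup fun i => (P.coeff i).natAbs

/-- The set of exponents `w` admissible for the uniform exponent `ŵ_n(ξ)`. -/
def uniformExpSet (n : ℕ) (ξ : ℝ) : Set ℝ :=
  {w | ∀ᶠ X : ℝ in atTop, ∃ P : Polynomial ℤ, P.natDegree ≤ n ∧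
    (polyHeight P : ℝ) ≤ X ∧ 0 < |Polynomial.aeval ξ P| ∧
    |Polynomial.aeval ξ P| < X ^ (-w)}

/-- The uniform exponent `ŵ_n(ξ)`, as an extended real. -/
def wHat (n : ℕ) (ξ : ℝ) : EReal :=
  sSup ((fun w : ℝ => (w : EReal)) '' uniformExpSet n ξ)

/-- The set of exponents `w` admissible for the ordinary exponent `w_n(ξ)`. -/
def ordExpSet (n : ℕ) (ξ : ℝ) : Set ℝ :=
  {w | {P : Polynomial ℤ | P.natDegree ≤ n ∧ 0 < |Polynomial.aeval ξ P| ∧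
      |Polynomial.aeval ξ P| < (polyHeight P : ℝ) ^ (-w)}.Infinite}

/-- The ordinary exponent `w_n(ξ)`, as an extended real. -/
def wOrd (n : ℕ) (ξ : ℝ) : EReal :=
  sSup ((fun w : ℝ => (w : EReal)) '' ordExpSet n ξ)

/-- `P` (1-indexed: the relevant values are `P 1, P 2, …`) is the sequence of best
approximation polynomials associated to `(n, ξ)`. -/
structure IsBestApproxSeq (n : ℕ) (ξ : ℝ) (P : ℕ → Polynomial ℤ) : Prop where
  ne_zero : ∀ k, 1 ≤ k → P k ≠ 0
  deg_le : ∀ k, 1 ≤ k → (P k).natDegree ≤ n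
  height_lt : ∀ k, 1 ≤ k → polyHeight (P k) < polyHeight (P (k+1))
  eval_lt : ∀ k, 1 ≤ k → |Polynomial.aeval ξ (P (k+1))| < |Polynomial.aeval ξ (P k)|
  isMin : ∀ k, 1 ≤ k → ∀ Q : Polynomial ℤ, Q ≠ 0 → Q.natDegree ≤ n →
    polyHeight Q ≤ polyHeight (P k) →
    |Polynomial.aeval ξ (P k)| ≤ |Polynomial.aeval ξ Q|
  complete : ∀ Q : Polynomial ℤ, Q ≠ 0 → Q.natDegree ≤ n →
    (∀ R : Polynomial ℤ, R ≠ 0 → R.natDegree ≤ n → polyHeight R ≤ polyHeight Q →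
      |Polynomial.aeval ξ Q| ≤ |Polynomial.aeval ξ R|) →
    ∃ k, 1 ≤ k ∧ (Q = P k ∨ Q = -P k)

/-- The image of an integer polynomial in `ℚ[X]`. -/
def ratPoly (P : Polynomial ℤ) : Polynomial ℚ := P.map (Int.castRingHom ℚ)

/-- `k` is good for the sequence `P`: `P_{k-1}, P_k, P_{k+1}` are `ℚ`-linearly independent. -/
def Good (P : ℕ → Polynomial ℤ) (k : ℕ) : Prop :=
  LinearIndependent ℚ ![ratPoly (P (k-1)), ratPoly (P k), ratPoly (P (k+1))]

/-- `τ_k = log H_k / log H_{k-1}`. -/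
def tauk (P : ℕ → Polynomial ℤ) (k : ℕ) : ℝ :=
  Real.log (polyHeight (P k)) / Real.log (polyHeight (P (k-1)))

/-- `μ_k = -log |P_{k-1}(ξ)| / log H_k`. -/
def muk (ξ : ℝ) (P : ℕ → Polynomial ℤ) (k : ℕ) : ℝ :=
  - Real.log |Polynomial.aeval ξ (P (k-1))| / Real.log (polyHeight (P k))

/-- `v_k = -log |P_k(ξ)| / log H_k`. -/
def vk (ξ : ℝ) (P : ℕ → Polynomial ℤ) (k : ℕ) : ℝ :=
  - Real.log |Polynomial.aeval ξ (P k)| / Real.log (polyHeight (P k))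

/-- The set of integers `m ≥ k+1` such that `P_{k-1}, …, P_{m-1}` all lie in the
two-dimensional space spanned by `P_{k-1}` and `P_k`; its greatest element is `ℓ(k)`. -/
def ellSet (P : ℕ → Polynomial ℤ) (k : ℕ) : Set ℕ :=
  {m | k + 1 ≤ m ∧ ∀ j, k - 1 ≤ j → j ≤ m - 1 →
    ratPoly (P j) ∈ Submodule.span ℚ {ratPoly (P (k-1)), ratPoly (P k)}}

/-- The set `V_k = {P, T·P, …, T^{n-2}·P}` (as rational polynomials). -/
def Vset (n : ℕ) (A : Polynomial ℤ) : Set (Polynomial ℚ) :=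
  {q | ∃ i ≤ n - 2, q = Polynomial.X ^ i * ratPoly A}

/-- The trajectory `L_P(q) = max(log H(P) - q/(2n-2), log |P(ξ)| + q)`. -/
def LPtraj (n : ℕ) (ξ : ℝ) (Q : Polynomial ℤ) (q : ℝ) : ℝ :=
  max (Real.log (polyHeight Q) - q / (2*(n:ℝ)-2)) (Real.log |Polynomial.aeval ξ Q| + q)

/-- The `j`-th successive minimum function `L_j(q)`: the infimum over sets of `j`
linearly independent integer polynomials of degree at most `2n-2` of the maximum of
`L_P(q)` over the set. -/
def Lj (n : ℕ) (ξ : ℝ) (j : ℕ) (q : ℝ) : ℝ :=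
  sInf {y : ℝ | ∃ S : Finset (Polynomial ℤ), S.card = j ∧
    (∀ Q ∈ S, Q.natDegree ≤ 2*n-2) ∧
    LinearIndependent ℚ (fun Q : {x // x ∈ S} => ratPoly (Q : Polynomial ℤ)) ∧
    y = sSup ((fun Q => LPtraj n ξ Q q) '' (S : Set (Polynomial ℤ)))}

/-! ### Heights and Mahler measures -/

lemma abs_coeff_le_polyHeight (P : ℤ[X]) (i : ℕ) : |(P.coeff i : ℝ)| ≤ polyHeight P := by
  by_cases hi : i ∈ P.support
  · have h : (P.coeff i).natAbs ≤ polyHeight P :=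
      Finset.le_sup (f := fun i => (P.coeff i).natAbs) hi
    rw [← Int.cast_abs, Int.abs_eq_natAbs]
    exact_mod_cast h
  · rw [notMem_support_iff.mp hi]
    simp

lemma exists_abs_coeff_eq_polyHeight {P : ℤ[X]} (hP : P ≠ 0) :
    ∃ i, |(P.coeff i : ℝ)| = polyHeight P := by
  obtain ⟨i, -, hi⟩ := Finset.exists_mem_eq_sup P.support (support_nonempty.mpr hP)
    (fun i => (P.coeff i).natAbs)
  refine ⟨i, ?_⟩
  rw [polyHeight, hi, ← Int.cast_abs, Int.abs_eq_natAbs]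
  simp

lemma one_le_polyHeight {P : ℤ[X]} (hP : P ≠ 0) : (1 : ℝ) ≤ polyHeight P := by
  refine le_trans ?_ (abs_coeff_le_polyHeight P P.natDegree)
  exact_mod_cast Int.one_le_abs (leadingCoeff_ne_zero.mpr hP)

/-- The Mahler measure of an integer polynomial. -/
def intMahler (P : ℤ[X]) : ℝ := (P.map (Int.castRingHom ℂ)).mahlerMeasure

lemma one_le_intMahler {P : ℤ[X]} (hP : P ≠ 0) : 1 ≤ intMahler P :=
  one_le_mahlerMeasure_of_ne_zero hP

lemma intMahler_mul (P Q : ℤ[X]) : intMahler (P * Q) = intMahler P * intMahler Q := by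
  simp [intMahler, Polynomial.map_mul, mahlerMeasure_mul]

lemma polyHeight_le_intMahler {n : ℕ} {P : ℤ[X]} (hP : P ≠ 0) (hd : P.natDegree ≤ n) :
    (polyHeight P : ℝ) ≤ 2 ^ n * intMahler P := by
  obtain ⟨i, hi⟩ := exists_abs_coeff_eq_polyHeight hP
  have h := norm_coeff_le_choose_mul_mahlerMeasure i (P.map (Int.castRingHom ℂ))
  rw [coeff_map, eq_intCast, Complex.norm_intCast, hi,
    natDegree_map_eq_of_injective (Int.castRingHom ℂ).injective_int] at h
  refine h.trans (mul_le_mul_of_nonneg_right ?_ (mahlerMeasure_nonneg _))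
  calc ((P.natDegree.choose i : ℕ) : ℝ) ≤ ((2 ^ P.natDegree : ℕ) : ℝ) := by
        exact_mod_cast Nat.choose_le_two_pow _ _
    _ ≤ 2 ^ n := by
        push_cast
        exact pow_le_pow_right₀ (by norm_num) hd

lemma intMahler_le_polyHeight {n : ℕ} {P : ℤ[X]} (hd : P.natDegree ≤ n) :
    intMahler P ≤ (n + 1) * polyHeight P := by
  refine (mahlerMeasure_le_sum_norm_coeff _).trans ?_
  rw [sum_over_range' _ (fun _ => norm_zero) (n + 1)
    (lt_of_le_of_lt natDegree_map_le (Nat.lt_succ_of_le hd))]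
  refine (Finset.sum_le_card_nsmul _ _ (polyHeight P : ℝ) fun i _ => ?_).trans ?_
  · rw [coeff_map, eq_intCast, Complex.norm_intCast]
    exact abs_coeff_le_polyHeight P i
  · simp

/-- A divisor cannot have much larger height than its multiple. -/
lemma polyHeight_le_of_dvd {n : ℕ} {P Q : ℤ[X]} (hPQ : P ∣ Q) (hQ : Q ≠ 0)
    (hd : Q.natDegree ≤ n) :
    (polyHeight P : ℝ) ≤ 2 ^ n * (n + 1) * polyHeight Q := by
  have hP : P ≠ 0 := ne_zero_of_dvd_ne_zero hQ hPQ
  have hdP : P.natDegree ≤ n := (natDegree_le_of_dvd hPQ hQ).trans hd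
  obtain ⟨R, rfl⟩ := hPQ
  have hR : R ≠ 0 := right_ne_zero_of_mul hQ
  calc (polyHeight P : ℝ) ≤ 2 ^ n * intMahler P := polyHeight_le_intMahler hP hdP
    _ ≤ 2 ^ n * intMahler (P * R) := by
        rw [intMahler_mul]
        gcongr
        exact le_mul_of_one_le_right (zero_le_one.trans (one_le_intMahler hP)) (one_le_intMahler hR)
    _ ≤ 2 ^ n * ((n + 1) * polyHeight (P * R)) := by
        gcongr
        exact intMahler_le_polyHeight hd
    _ = _ := by ring

/-- There are finitely many integer polynomials of bounded degree and height. -/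
lemma finite_polyHeight_le (n : ℕ) (B : ℝ) :
    {P : ℤ[X] | P.natDegree ≤ n ∧ (polyHeight P : ℝ) ≤ B}.Finite := by
  refine (finite_mahlerMeasure_le n (((n + 1) * B).toNNReal)).subset ?_
  rintro P ⟨hd, hB⟩
  refine ⟨hd, ((intMahler_le_polyHeight hd).trans ?_).trans (Real.le_coe_toNNReal _)⟩
  gcongr

/-! ### The resultant inequality -/

lemma abs_det_le_of_abs_le_mul {N : ℕ} (M : Matrix (Fin N) (Fin N) ℝ) (a b : Fin N → ℝ)
    (h : ∀ i j, |M i j| ≤ a i * b j) :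
    |M.det| ≤ N.factorial * ((∏ i, a i) * ∏ j, b j) := by
  rw [Matrix.det_apply']
  refine (Finset.abs_sum_le_sum_abs _ _).trans ?_
  refine (Finset.sum_le_card_nsmul _ _ ((∏ i, a i) * ∏ j, b j) fun σ _ => ?_).trans ?_
  · rw [abs_mul, Finset.abs_prod, ← Equiv.prod_comp σ a, ← Finset.prod_mul_distrib]
    have hs : |(((Equiv.Perm.sign σ : ℤˣ) : ℤ) : ℝ)| = 1 := by
      rcases Int.units_eq_one_or (Equiv.Perm.sign σ) with hs | hs <;> simp [hs]
    rw [hs, one_mul]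
    exact Finset.prod_le_prod (fun i _ => abs_nonneg _) fun i _ => h _ _
  · simp [Fintype.card_perm]

lemma sum_pow_mul_shifted_coeff {m n : ℕ} (f : ℤ[X]) (hf : f.natDegree ≤ n) (ξ : ℝ) {j : ℕ}
    (hj : j < m) :
    ∑ i : Fin (m + n), ξ ^ (i : ℕ) *
      ((if (i : ℕ) ∈ Set.Icc j (j + n) then f.coeff (i - j) else 0 : ℤ) : ℝ) =
      ξ ^ j * aeval ξ f := by
  rw [Fin.sum_univ_eq_sum_range (fun i => ξ ^ i *
      ((if i ∈ Set.Icc j (j + n) then f.coeff (i - j) else 0 : ℤ) : ℝ)),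
    aeval_eq_sum_range' (Nat.lt_succ_of_le hf), Finset.mul_sum]
  have hsub : (Finset.range (n + 1)).map (addLeftEmbedding j) ⊆ Finset.range (m + n) := by
    intro i hi
    simp only [Finset.mem_map, Finset.mem_range, addLeftEmbedding_apply] at hi ⊢
    omega
  rw [← Finset.sum_subset hsub, Finset.sum_map]
  · refine Finset.sum_congr rfl fun i hi => ?_
    rw [Finset.mem_range] at hi
    have hmem : j + i ∈ Set.Icc j (j + n) := ⟨by omega, by omega⟩
    simp only [addLeftEmbedding_apply, if_pos hmem, Nat.add_sub_cancel_left, zsmul_eq_mul]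
    ring
  · intro i _ hi
    rw [if_neg, Int.cast_zero, mul_zero]
    rintro ⟨h1, h2⟩
    refine hi (Finset.mem_map.mpr ⟨i - j, Finset.mem_range.mpr ?_, ?_⟩)
    · omega
    · simp only [addLeftEmbedding_apply]
      omega

/-- The resultant is small when both polynomials are small at a common point. -/
lemma abs_resultant_le {m n : ℕ} (hn : 0 < n) {P Q : ℤ[X]} (hP : P.natDegree ≤ m)
    (hQ : Q.natDegree ≤ n) (ξ : ℝ) {A B : ℝ} (hA : 0 < A) (hB : 0 < B)
    (hPA : (polyHeight P : ℝ) ≤ A) (hQB : (polyHeight Q : ℝ) ≤ B) :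
    |((resultant P Q m n : ℤ) : ℝ)| ≤ (m + n).factorial * (1 + |ξ|) ^ (m + n) *
      (A ^ n * B ^ m * (|aeval ξ P| / A + |aeval ξ Q| / B)) := by
  set S : Matrix (Fin (m + n)) (Fin (m + n)) ℝ :=
    (Int.castRingHom ℝ).mapMatrix (sylvester P Q m n) with hS
  have hdet : ((resultant P Q m n : ℤ) : ℝ) = S.det := by
    rw [hS, ← RingHom.map_det]
    rfl
  let i₀ : Fin (m + n) := ⟨0, by omega⟩
  set ε : ℝ := (1 + |ξ|) ^ (m + n) * (|aeval ξ P| / A + |aeval ξ Q| / B) with hε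
  let a : Fin (m + n) → ℝ := Function.update 1 i₀ ε
  let b : Fin (m + n) → ℝ := fun j => j.addCases (fun _ => B) (fun _ => A)
  have hrow : (S.updateRow i₀ (∑ k : Fin (m + n), ξ ^ (k : ℕ) • S k)).det = S.det := by
    rw [Matrix.det_updateRow_sum]
    simp [i₀]
  have hξ : ∀ j : ℕ, j ≤ m + n → |ξ| ^ j ≤ (1 + |ξ|) ^ (m + n) := fun j hj =>
    (pow_le_pow_left₀ (abs_nonneg ξ) (by linarith) j).trans
      (pow_le_pow_right₀ (by linarith [abs_nonneg ξ]) hj)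
  have hbound : ∀ i j, |(S.updateRow i₀ (∑ k : Fin (m + n), ξ ^ (k : ℕ) • S k)) i j| ≤ a i * b j := by
    intro i j
    by_cases hi : i = i₀
    · subst hi
      rw [Matrix.updateRow_self]
      simp only [a, Function.update_self, Finset.sum_apply, Pi.smul_apply, smul_eq_mul]
      induction j using Fin.addCases with
      | left j =>
        have h := sum_pow_mul_shifted_coeff (m := m) Q hQ ξ j.2
        simp only [hS, RingHom.mapMatrix_apply, Matrix.map_apply, sylvester, Matrix.of_apply,
          Fin.addCases_left, eq_intCast, b]
        rw [h, abs_mul, abs_pow, hε]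
        have h1 := mul_le_mul_of_nonneg_right (hξ j (by omega)) (abs_nonneg (aeval ξ Q))
        have h2 : 0 ≤ (1 + |ξ|) ^ (m + n) * (|aeval ξ P| / A) * B := by positivity
        calc _ ≤ _ := h1
          _ = (1 + |ξ|) ^ (m + n) * (|aeval ξ Q| / B) * B := by field_simp
          _ ≤ _ := by linarith
      | right j =>
        have h := sum_pow_mul_shifted_coeff (m := n) (n := m) P hP ξ j.2
        have h' : ∑ i : Fin (m + n), ξ ^ (i : ℕ) * ((if (i : ℕ) ∈ Set.Icc (j : ℕ) (j + m)
            then P.coeff (i - j) else 0 : ℤ) : ℝ) = ξ ^ (j : ℕ) * aeval ξ P := by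
          rw [← h]
          exact Fintype.sum_equiv (finCongr (add_comm m n)) _ _ fun i => rfl
        simp only [hS, RingHom.mapMatrix_apply, Matrix.map_apply, sylvester, Matrix.of_apply,
          Fin.addCases_right, eq_intCast, b]
        rw [h', abs_mul, abs_pow, hε]
        have h1 := mul_le_mul_of_nonneg_right (hξ j (by omega)) (abs_nonneg (aeval ξ P))
        have h2 : 0 ≤ (1 + |ξ|) ^ (m + n) * (|aeval ξ Q| / B) * A := by positivity
        calc _ ≤ _ := h1
          _ = (1 + |ξ|) ^ (m + n) * (|aeval ξ P| / A) * A := by field_simp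
          _ ≤ _ := by linarith
    · rw [Matrix.updateRow_ne hi]
      simp only [a, Function.update_of_ne hi, Pi.one_apply, one_mul, hS,
        RingHom.mapMatrix_apply, Matrix.map_apply, sylvester, Matrix.of_apply, eq_intCast]
      induction j using Fin.addCases with
      | left j =>
        simp only [Fin.addCases_left, b]
        split_ifs
        · exact (abs_coeff_le_polyHeight _ _).trans hQB
        · simpa using hB.le
      | right j =>
        simp only [Fin.addCases_right, b]
        split_ifs
        · exact (abs_coeff_le_polyHeight _ _).trans hPA
        · simpa using hA.le
  have ha : ∏ i, a i = ε := by
    simp [a, Finset.prod_update_of_mem]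
  have hb : ∏ j, b j = B ^ m * A ^ n := by
    simp [b, Fin.prod_univ_add]
  have := abs_det_le_of_abs_le_mul _ a b hbound
  rw [hrow, ha, hb] at this
  rw [hdet]
  refine this.trans (le_of_eq ?_)
  rw [hε]
  ring

lemma resultant_ne_zero_of_not_dvd {n : ℕ} {P Q : ℤ[X]} (hP : Irreducible P)
    (hP0 : P.natDegree ≠ 0) (hQ : Q.natDegree ≤ n) (hPQ : ¬ P ∣ Q) :
    resultant P Q P.natDegree n ≠ 0 := by
  have hprim : P.IsPrimitive := hP.isPrimitive hP0
  have hinj : Function.Injective (Int.castRingHom ℚ) := (Int.castRingHom ℚ).injective_int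
  have hirr := (IsPrimitive.Int.irreducible_iff_irreducible_map_cast hprim).mp hP
  have hndvd := fun h => hPQ ((IsPrimitive.Int.dvd_iff_map_cast_dvd_map_cast P Q hprim).mpr h)
  have hcop := (hirr.coprime_iff_not_dvd).mpr hndvd
  have hres : resultant P Q ≠ 0 := by
    intro h
    have h' : resultant (P.map (Int.castRingHom ℚ)) (Q.map (Int.castRingHom ℚ)) = 0 := by
      rw [natDegree_map_eq_of_injective hinj, natDegree_map_eq_of_injective hinj,
        resultant_map_map, h, map_zero]
    exact (resultant_eq_zero_iff.mp h').2 hcop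
  obtain ⟨k, rfl⟩ := Nat.exists_eq_add_of_le hQ
  rw [resultant_add_right_deg _ _ _ _ _ le_rfl]
  exact mul_ne_zero (pow_ne_zero _ (leadingCoeff_ne_zero.mpr hP.ne_zero)) hres

/-- Liouville-type inequality for coprime integer polynomials. -/
lemma one_le_of_not_dvd {m n : ℕ} (hn : 0 < n) {P Q : ℤ[X]} (hP : Irreducible P)
    (hm : P.natDegree = m) (hm0 : m ≠ 0) (hQ : Q.natDegree ≤ n) (hPQ : ¬ P ∣ Q) (ξ : ℝ) {A B : ℝ}
    (hA : 0 < A) (hB : 0 < B)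
    (hPA : (polyHeight P : ℝ) ≤ A) (hQB : (polyHeight Q : ℝ) ≤ B) :
    1 ≤ (m + n).factorial * (1 + |ξ|) ^ (m + n) *
      (A ^ n * B ^ m * (|aeval ξ P| / A + |aeval ξ Q| / B)) := by
  refine le_trans ?_ (abs_resultant_le hn hm.le hQ ξ hA hB hPA hQB)
  have h := resultant_ne_zero_of_not_dvd hP (hm ▸ hm0) hQ hPQ
  rw [hm] at h
  exact_mod_cast Int.one_le_abs h

/-! ### Reduction to irreducible polynomials -/

lemma exists_pos_le_of_finite {α : Type*} {s : Set α} (hs : s.Finite) (f : α → ℝ)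
    (hf : ∀ x ∈ s, 0 < f x) : ∃ c : ℝ, 0 < c ∧ c ≤ 1 ∧ ∀ x ∈ s, c ≤ f x := by
  rcases s.eq_empty_or_nonempty with rfl | hne
  · exact ⟨1, one_pos, le_rfl, by simp⟩
  · obtain ⟨x, hx, hmin⟩ := Set.exists_min_image s f hs hne
    exact ⟨min 1 (f x), lt_min one_pos (hf x hx), min_le_left _ _,
      fun y hy => (min_le_right _ _).trans (hmin y hy)⟩

lemma one_le_abs_aeval_of_natDegree_eq_zero {P : ℤ[X]} {ξ : ℝ} (hd : P.natDegree = 0)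
    (hP : P ≠ 0) : 1 ≤ |aeval ξ P| := by
  rw [eq_C_of_natDegree_eq_zero hd] at hP ⊢
  have h : P.coeff 0 ≠ 0 := fun h => hP (by rw [h, map_zero])
  rw [aeval_C, eq_intCast]
  exact_mod_cast Int.one_le_abs h

/-- A lower bound at irreducible polynomials propagates to all polynomials. -/
lemma pow_mul_intMahler_rpow_le {n : ℕ} {ξ c w : ℝ} (hc : 0 < c) (hc1 : c ≤ 1) (hw : 0 ≤ w)
    (h : ∀ P : ℤ[X], Irreducible P → P.natDegree ≤ n → aeval ξ P ≠ 0 →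
      c * intMahler P ^ (-w) ≤ |aeval ξ P|)
    (P : ℤ[X]) (hd : P.natDegree ≤ n) (hξ : aeval ξ P ≠ 0) :
    c ^ P.natDegree * intMahler P ^ (-w) ≤ |aeval ξ P| := by
  have hconst : ∀ P : ℤ[X], P ≠ 0 → P.natDegree = 0 →
      c ^ P.natDegree * intMahler P ^ (-w) ≤ |aeval ξ P| := fun P hP hd => by
    rw [hd, pow_zero, one_mul]
    exact (Real.rpow_le_one_of_one_le_of_nonpos (one_le_intMahler hP) (by linarith)).trans
      (one_le_abs_aeval_of_natDegree_eq_zero hd hP)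
  induction P using UniqueFactorizationMonoid.induction_on_prime with
  | h₁ => simp at hξ
  | h₂ P hP => exact hconst P hP.ne_zero (natDegree_eq_zero_of_isUnit hP)
  | h₃ P R hP hR ih =>
    rw [map_mul] at hξ
    have hdeg := natDegree_mul hR.ne_zero hP
    rw [hdeg] at hd
    have hRξ : c ^ R.natDegree * intMahler R ^ (-w) ≤ |aeval ξ R| := by
      rcases Nat.eq_zero_or_pos R.natDegree with h0 | h0
      · exact hconst R hR.ne_zero h0
      · refine le_trans ?_ (h R hR.irreducible (by omega) (left_ne_zero_of_mul hξ))
        have hM := zero_le_one.trans (one_le_intMahler hR.ne_zero)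
        gcongr
        exact pow_le_of_le_one hc.le hc1 h0.ne'
    have hPξ := ih (by omega) (right_ne_zero_of_mul hξ)
    have hMR := zero_le_one.trans (one_le_intMahler hR.ne_zero)
    have hMP := zero_le_one.trans (one_le_intMahler hP)
    rw [hdeg, intMahler_mul, map_mul, abs_mul, Real.mul_rpow hMR hMP, pow_add]
    calc _ = (c ^ R.natDegree * intMahler R ^ (-w)) * (c ^ P.natDegree * intMahler P ^ (-w)) := by
          ring
      _ ≤ _ := by gcongr

lemma infinite_irreducible_of_mem_ordExpSet {n : ℕ} {ξ w v : ℝ} (hv : 0 ≤ v) (hvw : v < w)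
    (hw : w ∈ ordExpSet n ξ) :
    {P : ℤ[X] | Irreducible P ∧ P.natDegree ≤ n ∧ 0 < |aeval ξ P| ∧
      |aeval ξ P| < (polyHeight P : ℝ) ^ (-v)}.Infinite := by
  intro hfin
  obtain ⟨c, hc, hc1, hcle⟩ := exists_pos_le_of_finite hfin (fun P => |aeval ξ P|)
    fun P hP => hP.2.2.1
  have hirr : ∀ P : ℤ[X], Irreducible P → P.natDegree ≤ n → aeval ξ P ≠ 0 →
      c * (2 ^ n) ^ (-v) * intMahler P ^ (-v) ≤ |aeval ξ P| := by
    intro P hP hd hξ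
    have hH := one_le_polyHeight hP.ne_zero
    have hM := one_le_intMahler hP.ne_zero
    have hle : (2 ^ n : ℝ) ^ (-v) * intMahler P ^ (-v) ≤ (polyHeight P : ℝ) ^ (-v) := by
      rw [← Real.mul_rpow (by positivity) (by positivity)]
      exact Real.rpow_le_rpow_of_nonpos (by positivity) (polyHeight_le_intMahler hP.ne_zero hd)
        (by linarith)
    have hH1 : (polyHeight P : ℝ) ^ (-v) ≤ 1 :=
      Real.rpow_le_one_of_one_le_of_nonpos hH (by linarith)
    have hH0 : 0 ≤ (polyHeight P : ℝ) ^ (-v) := by positivity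
    rw [mul_assoc]
    refine (mul_le_mul_of_nonneg_left hle hc.le).trans ?_
    by_cases hmem : |aeval ξ P| < (polyHeight P : ℝ) ^ (-v)
    · exact (mul_le_of_le_one_right hc.le hH1).trans (hcle P ⟨hP, hd, abs_pos.mpr hξ, hmem⟩)
    · exact (mul_le_of_le_one_left hH0 hc1).trans (not_lt.mp hmem)
  set d : ℝ := c * (2 ^ n) ^ (-v) with hd
  have hd0 : 0 < d := by positivity
  have hd1 : d ≤ 1 := mul_le_one₀ hc1 (by positivity)
    (Real.rpow_le_one_of_one_le_of_nonpos (one_le_pow₀ (by norm_num)) (by linarith))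
  refine hw ((finite_polyHeight_le n ((d ^ n * (n + 1) ^ (-v))⁻¹ ^ (w - v)⁻¹)).subset ?_)
  rintro P ⟨hdeg, hξ, hlt⟩
  refine ⟨hdeg, ?_⟩
  have hP : P ≠ 0 := by
    rintro rfl
    simp at hξ
  have hH := one_le_polyHeight hP
  have hM := one_le_intMahler hP
  have hlow := pow_mul_intMahler_rpow_le hd0 hd1 hv hirr P hdeg (abs_pos.mp hξ)
  have hchain : d ^ n * (n + 1) ^ (-v) * (polyHeight P : ℝ) ^ (-v) < (polyHeight P : ℝ) ^ (-w) := by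
    refine lt_of_le_of_lt ?_ hlt
    refine le_trans ?_ hlow
    rw [mul_assoc, ← Real.mul_rpow (by positivity) (by positivity)]
    have h1 : d ^ n ≤ d ^ P.natDegree := pow_le_pow_of_le_one hd0.le hd1 hdeg
    have h2 : ((n + 1) * polyHeight P : ℝ) ^ (-v) ≤ intMahler P ^ (-v) :=
      Real.rpow_le_rpow_of_nonpos (by positivity) (intMahler_le_polyHeight hdeg) (by linarith)
    gcongr
  have hpow : (polyHeight P : ℝ) ^ (w - v) ≤ (d ^ n * (n + 1) ^ (-v))⁻¹ := by
    rw [le_inv_comm₀ (by positivity) (by positivity), ← Real.rpow_neg (by positivity)]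
    have h3 : (polyHeight P : ℝ) ^ (-(w - v)) =
        (polyHeight P : ℝ) ^ (-w) * (polyHeight P : ℝ) ^ v := by
      rw [← Real.rpow_add (by positivity)]
      congr 1
      ring
    have h4 : (polyHeight P : ℝ) ^ (-v) * (polyHeight P : ℝ) ^ v = 1 := by
      rw [← Real.rpow_add (by positivity)]
      simp
    rw [h3]
    calc _ = d ^ n * (n + 1) ^ (-v) * ((polyHeight P : ℝ) ^ (-v) * (polyHeight P : ℝ) ^ v) := by
          rw [h4, mul_one]
      _ ≤ _ := by
          rw [← mul_assoc]
          gcongr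
  calc (polyHeight P : ℝ) = ((polyHeight P : ℝ) ^ (w - v)) ^ (w - v)⁻¹ := by
        rw [← Real.rpow_mul (by positivity), mul_inv_cancel₀ (by linarith), Real.rpow_one]
    _ ≤ _ := Real.rpow_le_rpow (by positivity) hpow (by simp; linarith)

/-! ### The exponents -/

lemma mem_uniformExpSet_of_le {n : ℕ} {ξ u v : ℝ} (hu : u ∈ uniformExpSet n ξ) (hvu : v ≤ u) :
    v ∈ uniformExpSet n ξ := by
  filter_upwards [hu, eventually_ge_atTop 1] with X ⟨P, hd, hH, h0, hlt⟩ hX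
  exact ⟨P, hd, hH, h0,
    hlt.trans_le (Real.rpow_le_rpow_of_exponent_le hX (by linarith))⟩

lemma mem_ordExpSet_of_mem_uniformExpSet {n : ℕ} {ξ u : ℝ} (hu : 0 < u)
    (h : u ∈ uniformExpSet n ξ) : u ∈ ordExpSet n ξ := by
  intro hfin
  obtain ⟨c, hc, -, hcle⟩ := exists_pos_le_of_finite hfin (fun P => |aeval ξ P|)
    fun P hP => hP.2.1
  have hsmall : ∀ᶠ X : ℝ in atTop, X ^ (-u) < c := (tendsto_rpow_neg_atTop hu).eventually_lt_const hc
  obtain ⟨X, ⟨P, hd, hH, h0, hlt⟩, hXc, hX⟩ := (h.and (hsmall.and (eventually_ge_atTop 1))).exists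
  have hP : P ≠ 0 := by
    rintro rfl
    simp at h0
  have hH1 := one_le_polyHeight hP
  have hmem := hcle P ⟨hd, h0,
    hlt.trans_le (Real.rpow_le_rpow_of_nonpos (by positivity) hH (by linarith))⟩
  linarith

/-- Two different ways in which a well-approximating irreducible polynomial `P` is combined with
a polynomial `Q` coprime to it, according to whether `P` has degree less than `n` or equal to `n`,
both lead to a contradiction. -/
lemma false_of_infinite_irreducible {n : ℕ} (hn : 2 ≤ n) {ξ u w : ℝ}
    (hu : u ∈ uniformExpSet n ξ) (hun : 2 * (n : ℝ) - 2 < u) (huw : u < w)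
    (hlt : u * (n - 1) < w * (u - n))
    (hinf : {P : ℤ[X] | Irreducible P ∧ P.natDegree ≤ n ∧ 0 < |aeval ξ P| ∧
      |aeval ξ P| < (polyHeight P : ℝ) ^ (-w)}.Infinite) : False := by
  have hn' : (2 : ℝ) ≤ n := by exact_mod_cast hn
  have hu0 : 0 < u := by linarith
  have hnu : (n : ℝ) < u := by linarith
  obtain ⟨X₀, hX₀⟩ := eventually_atTop.mp hu
  set K : ℝ := (n + n).factorial * (1 + |ξ|) ^ (n + n) with hK
  have hK0 : 0 < K := by positivity
  have hKm : ∀ m ≤ n, ((m + n).factorial : ℝ) * (1 + |ξ|) ^ (m + n) ≤ K := by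
    intro m hm
    rw [hK]
    gcongr
    linarith [abs_nonneg ξ]
  set c : ℝ := (2 * (2 ^ n * (n + 1)))⁻¹ with hc
  have hc0 : 0 < c := by positivity
  have hc1 : c ≤ 1 := by
    refine inv_le_one_of_one_le₀ ?_
    have : (1 : ℝ) ≤ 2 ^ n := one_le_pow₀ (by norm_num)
    nlinarith
  -- the exponents of the height in the two final inequalities are negative
  have hexp₁ : 0 < u - (2 * n - 2) := by linarith
  have hexp₂ : 0 < w / u * (u - n) - (n - 1) := by
    rw [div_mul_eq_mul_div, sub_pos, lt_div_iff₀ hu0]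
    linarith
  have hlim₁ : ∀ᶠ H : ℝ in atTop,
      H ^ (-(u - (2 * n - 2))) < (K * (1 + c ^ (-u - 1)))⁻¹ :=
    (tendsto_rpow_neg_atTop hexp₁).eventually_lt_const (by positivity)
  have hlim₂ : ∀ᶠ H : ℝ in atTop,
      H ^ (-(w / u * (u - n) - (n - 1))) < (K * 2)⁻¹ :=
    (tendsto_rpow_neg_atTop hexp₂).eventually_lt_const (by positivity)
  obtain ⟨H₀, hH₀⟩ := eventually_atTop.mp (hlim₁.and hlim₂)
  obtain ⟨P, ⟨hP, hdeg, hξ, hPlt⟩, hbig⟩ := hinf.exists_notMem_finite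
    (finite_polyHeight_le n (max H₀ (max X₀ 1 / c)))
  have hHbig : max H₀ (max X₀ 1 / c) < polyHeight P := by
    by_contra hle
    exact hbig ⟨hdeg, not_lt.mp hle⟩
  set H : ℝ := (polyHeight P : ℝ)
  have hH1 : 1 ≤ H := one_le_polyHeight hP.ne_zero
  have hHpos : 0 < H := by linarith
  obtain ⟨hfin₁, hfin₂⟩ := hH₀ H ((le_max_left _ _).trans hHbig.le)
  have hcH : max X₀ 1 < c * H := by
    have := (le_max_right _ _).trans_lt hHbig
    rw [div_lt_iff₀ hc0] at this
    linarith
  have hPu : |aeval ξ P| < H ^ (-u) :=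
    hPlt.trans_le (Real.rpow_le_rpow_of_exponent_le hH1 (by linarith))
  have hm0 : P.natDegree ≠ 0 := by
    intro h0
    have h1 := one_le_abs_aeval_of_natDegree_eq_zero (ξ := ξ) h0 hP.ne_zero
    have h2 : H ^ (-u) ≤ 1 := Real.rpow_le_one_of_one_le_of_nonpos hH1 (by linarith)
    linarith
  rcases hdeg.lt_or_eq with hlow | htop
  · set X : ℝ := c * H with hX
    have hX1 : 1 < X := (le_max_right _ _).trans_lt hcH
    have hXH : X ≤ H := mul_le_of_le_one_left hHpos.le hc1
    obtain ⟨Q, hQd, hQH, hQ0, hQlt⟩ := hX₀ X ((le_max_left _ _).trans hcH.le)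
    have hQ : Q ≠ 0 := by
      rintro rfl
      simp at hQ0
    have hndvd : ¬ P ∣ Q := by
      intro hdvd
      have h1 := polyHeight_le_of_dvd hdvd hQ hQd
      have h2 : (2 : ℝ) ^ n * (n + 1) * polyHeight Q ≤ 2 ^ n * (n + 1) * X := by gcongr
      have h3 : (2 : ℝ) ^ n * (n + 1) * X = H / 2 := by
        rw [hX, hc]
        field_simp
      linarith
    have hres := one_le_of_not_dvd (by omega) hP rfl hm0 hQd hndvd ξ hHpos (by linarith : 0 < X)
      le_rfl hQH
    have hsum : |aeval ξ P| / H + |aeval ξ Q| / X ≤ (1 + c ^ (-u - 1)) * H ^ (-u - 1) := by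
      have h1 : |aeval ξ P| / H ≤ H ^ (-u - 1) := by
        rw [Real.rpow_sub_one hHpos.ne']
        gcongr
      have h2 : |aeval ξ Q| / X ≤ c ^ (-u - 1) * H ^ (-u - 1) := by
        rw [← Real.mul_rpow hc0.le hHpos.le, ← hX, Real.rpow_sub_one (by positivity)]
        gcongr
      linarith
    have hprod : H ^ n * X ^ P.natDegree ≤ H ^ (2 * (n : ℝ) - 1) := by
      calc H ^ n * X ^ P.natDegree ≤ H ^ n * H ^ P.natDegree := by gcongr
        _ ≤ H ^ n * H ^ (n - 1) := by
            gcongr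
            omega
        _ = H ^ (2 * (n : ℝ) - 1) := by
            rw [← pow_add, ← Real.rpow_natCast]
            congr 1
            rw [Nat.cast_add, Nat.cast_sub (by omega)]
            push_cast
            ring
    have htotal : 1 ≤ K * (1 + c ^ (-u - 1)) * H ^ (-(u - (2 * n - 2))) := by
      calc 1 ≤ _ := hres
        _ ≤ K * (H ^ (2 * (n : ℝ) - 1) * ((1 + c ^ (-u - 1)) * H ^ (-u - 1))) := by
            gcongr
            exact hKm _ hdeg
        _ = K * (1 + c ^ (-u - 1)) * (H ^ (2 * (n : ℝ) - 1) * H ^ (-u - 1)) := by ring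
        _ = _ := by
            rw [← Real.rpow_add hHpos]
            congr 2
            ring
    rw [lt_inv_comm₀ (by positivity) (by positivity), lt_inv_comm₀ (by positivity) (by positivity),
      ← one_div, lt_div_iff₀ (by positivity)] at hfin₁
    linarith
  · set X : ℝ := |aeval ξ P| ^ (-(1 / u)) with hX
    have hXpos : 0 < X := by positivity
    have hXu : X ^ (-u) = |aeval ξ P| := by
      rw [hX, ← Real.rpow_mul hξ.le]
      field_simp
      simp
    have hXw : H ^ (w / u) ≤ X := by
      have h1 := Real.rpow_le_rpow_of_nonpos hξ hPlt.le
        (by simpa using hu0.le : -(1 / u) ≤ 0)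
      rw [← Real.rpow_mul hHpos.le] at h1
      calc _ = _ := by congr 1; ring
        _ ≤ _ := h1
    have hHX : H ≤ X := by
      refine le_trans ?_ hXw
      conv_lhs => rw [← Real.rpow_one H]
      exact Real.rpow_le_rpow_of_exponent_le hH1 (by rw [le_div_iff₀ hu0]; linarith)
    have hX₀X : X₀ ≤ X := by
      have h1 := (le_max_left X₀ 1).trans hcH.le
      have h2 : c * H ≤ H := mul_le_of_le_one_left hHpos.le hc1
      linarith
    obtain ⟨Q, hQd, hQH, hQ0, hQlt⟩ := hX₀ X hX₀X
    rw [hXu] at hQlt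
    have hndvd : ¬ P ∣ Q := by
      rintro ⟨R, rfl⟩
      have hR : R ≠ 0 := by
        rintro rfl
        simp at hQ0
      rw [natDegree_mul hP.ne_zero hR] at hQd
      have h1 := one_le_abs_aeval_of_natDegree_eq_zero (ξ := ξ) (by omega : R.natDegree = 0) hR
      rw [map_mul, abs_mul] at hQlt
      exact absurd hQlt (not_lt.mpr (le_mul_of_one_le_right hξ.le h1))
    have hres := one_le_of_not_dvd (by omega) hP htop (by omega) hQd hndvd ξ hHpos hXpos
      le_rfl hQH
    have hsum : |aeval ξ P| / H + |aeval ξ Q| / X ≤ 2 * X ^ (-u) / H := by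
      have h1 : |aeval ξ Q| / X ≤ X ^ (-u) / H := by
        rw [hXu]
        gcongr
      rw [hXu] at h1 ⊢
      rw [mul_div_assoc]
      linarith
    have hXn : X ^ n * X ^ (-u) ≤ H ^ (w / u * (n - u)) := by
      rw [← Real.rpow_natCast, ← Real.rpow_add hXpos, Real.rpow_mul hHpos.le]
      exact Real.rpow_le_rpow_of_nonpos (by positivity) hXw (by linarith)
    have hHn : H ^ n / H = H ^ ((n : ℝ) - 1) := by
      rw [Real.rpow_sub_one hHpos.ne', Real.rpow_natCast]
    have htotal : 1 ≤ K * 2 * H ^ (-(w / u * (u - n) - (n - 1))) := by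
      calc 1 ≤ _ := hres
        _ ≤ K * (H ^ n * X ^ n * (2 * X ^ (-u) / H)) := by
            gcongr
        _ = K * 2 * (H ^ n / H * (X ^ n * X ^ (-u))) := by ring
        _ ≤ K * 2 * (H ^ ((n : ℝ) - 1) * H ^ (w / u * (n - u))) := by
            rw [hHn]
            gcongr
        _ = _ := by
            rw [← Real.rpow_add hHpos]
            congr 2
            ring
    rw [lt_inv_comm₀ (by positivity) (by positivity), lt_inv_comm₀ (by positivity) (by positivity),
      ← one_div, lt_div_iff₀ (by positivity)] at hfin₂
    linarith

lemma mul_sub_le_of_mem {n : ℕ} (hn : 2 ≤ n) {ξ u w : ℝ} (hu : u ∈ uniformExpSet n ξ)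
    (hun : 2 * (n : ℝ) - 2 < u) (hw : w ∈ ordExpSet n ξ) :
    w * (u - n) ≤ u * (n - 1) := by
  by_contra! hlt
  have hn' : (2 : ℝ) ≤ n := by exact_mod_cast hn
  have hmem : max u w ∈ ordExpSet n ξ := by
    rcases max_choice u w with h | h <;> rw [h]
    · exact mem_ordExpSet_of_mem_uniformExpSet (by linarith) hu
    · exact hw
  have hlt' : u * (n - 1) < max u w * (u - n) :=
    hlt.trans_le (mul_le_mul_of_nonneg_right (le_max_right _ _) (by linarith))
  set v := max u w
  have huv : u ≤ v := le_max_left _ _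
  -- perturb both exponents so that the inequalities between them become strict
  have h1 : ∀ᶠ ε : ℝ in nhds 0, 2 * (n : ℝ) - 2 < u - 2 * ε :=
    ContinuousAt.eventually_lt (by fun_prop) (by fun_prop) (by simpa using hun)
  have h2 : ∀ᶠ ε : ℝ in nhds 0, (u - 2 * ε) * (n - 1) < (v - ε) * (u - 2 * ε - n) :=
    ContinuousAt.eventually_lt (by fun_prop) (by fun_prop) (by simpa using hlt')
  obtain ⟨ε, ⟨hε1, hε2⟩, hε : 0 < ε⟩ :=
    (((h1.and h2).filter_mono nhdsWithin_le_nhds).and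
      (self_mem_nhdsWithin : Set.Ioi (0 : ℝ) ∈ nhdsWithin 0 (Set.Ioi 0))).exists
  exact false_of_infinite_irreducible hn (mem_uniformExpSet_of_le hu (by linarith)) hε1
    (by linarith : u - 2 * ε < v - ε) hε2
    (infinite_irreducible_of_mem_ordExpSet (by linarith) (by linarith) hmem)

/-- if `2n-2 < ŵ_n(ξ) < ∞` then `w_n(ξ)` is finite and
`w_n(ξ)/ŵ_n(ξ) ≤ (n-1)/(ŵ_n(ξ)-n)`. -/
theorem stmt5 (n : ℕ) (hn : 2 ≤ n) (ξ : ℝ)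
    (h1 : ((2*(n:ℝ)-2 : ℝ) : EReal) < wHat n ξ) (h2 : wHat n ξ < ⊤) :
    wOrd n ξ < ⊤ ∧
    (wOrd n ξ).toReal / (wHat n ξ).toReal ≤
      ((n:ℝ)-1) / ((wHat n ξ).toReal - (n:ℝ)) := by
  have hn' : (2 : ℝ) ≤ n := by exact_mod_cast hn
  have hmem : ∀ u : ℝ, (u : EReal) < wHat n ξ → u ∈ uniformExpSet n ξ := by
    intro u hu
    obtain ⟨_, ⟨v, hv, rfl⟩, huv⟩ := lt_sSup_iff.mp hu
    exact mem_uniformExpSet_of_le hv (EReal.coe_lt_coe_iff.mp huv).le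
  obtain ⟨u₀, hu₀, hu₀'⟩ := EReal.lt_iff_exists_real_btwn.mp h1
  rw [EReal.coe_lt_coe_iff] at hu₀
  have hbound : ∀ u : ℝ, 2 * (n : ℝ) - 2 < u → (u : EReal) < wHat n ξ →
      wOrd n ξ ≤ ((u * (n - 1) / (u - n) : ℝ) : EReal) := by
    intro u hu hu'
    refine sSup_le ?_
    rintro _ ⟨w, hw, rfl⟩
    rw [EReal.coe_le_coe_iff, le_div_iff₀ (by linarith)]
    exact mul_sub_le_of_mem hn (hmem u hu') hu hw
  have hfin : wOrd n ξ < ⊤ := (hbound u₀ hu₀ hu₀').trans_lt (EReal.coe_lt_top _)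
  refine ⟨hfin, ?_⟩
  have hbot : (⊥ : EReal) < wOrd n ξ := lt_of_lt_of_le (EReal.bot_lt_coe u₀)
    (le_sSup ⟨u₀, mem_ordExpSet_of_mem_uniformExpSet (by linarith) (hmem u₀ hu₀'), rfl⟩)
  have hW := EReal.coe_toReal hfin.ne hbot.ne'
  have hV := EReal.coe_toReal h2.ne (bot_le.trans_lt h1).ne'
  set W : ℝ := (wOrd n ξ).toReal
  set V : ℝ := (wHat n ξ).toReal
  rw [← hV, EReal.coe_lt_coe_iff] at h1
  rw [div_le_div_iff₀ (by linarith) (by linarith), mul_comm ((n : ℝ) - 1)]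
  have hev : ∀ᶠ u in nhdsWithin V (Set.Iio V), W * (u - n) ≤ u * (n - 1) := by
    filter_upwards [Ioo_mem_nhdsLT h1] with u hu
    have h := hbound u hu.1 (hV ▸ EReal.coe_lt_coe_iff.mpr hu.2)
    rw [← hW, EReal.coe_le_coe_iff, le_div_iff₀ (by linarith [hu.1])] at h
    exact h
  refine le_of_tendsto_of_tendsto ?_ ?_ hev
  · exact (Continuous.tendsto (by fun_prop) V).mono_left nhdsWithin_le_nhds
  · exact (Continuous.tendsto (by fun_prop) V).mono_left nhdsWithin_le_nhds
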